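/- Let n ≥ 2 and m ≥ 1 be integers and let k be an integer with 0 ≤ k < n. There exists a constant C > 0, depending only on k, n and m, such that for every ℓ > 0, every real a with 0 < a ≤ ℓ, and every n-times continuously differentiable function H : [0, ℓ] → ℝ^m, one has a^{2k} sup_{θ ∈ [0,ℓ]} ‖H^{(k)}(θ)‖² ≤ C ( a^{-1} ∫₀^ℓ ‖H(θ)‖² dθ + a^{2n-1} ∫₀^ℓ ‖H^{(n)}(θ)‖² dθ ). -/

import Mathlib

open MeasureTheory Set

theorem exists_polynomial_moment_eq (n : ℕ) (v : Fin n → ℝ) :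
    ∃ w : Polynomial ℝ, ∀ j : Fin n, ∫ s in (0:ℝ)..1, w.eval s * s ^ (j : ℕ) = v j := by
  let P : (Fin n → ℝ) →ₗ[ℝ] Polynomial ℝ :=
    { toFun := fun c => ∑ i : Fin n, Polynomial.monomial (i : ℕ) (c i)
      map_add' := fun c d => by simp [Finset.sum_add_distrib]
      map_smul' := fun r c => by simp [Finset.smul_sum, Polynomial.smul_monomial] }
  have hint : ∀ (p q : Polynomial ℝ),
      IntervalIntegrable (fun s => p.eval s * q.eval s) volume (0:ℝ) 1 := fun p q =>
    (p.continuous.mul q.continuous).intervalIntegrable _ _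
  let T : (Fin n → ℝ) →ₗ[ℝ] (Fin n → ℝ) :=
    { toFun := fun c j => ∫ s in (0:ℝ)..1, (P c).eval s * s ^ (j : ℕ)
      map_add' := fun c d => by
        ext j
        have h := intervalIntegral.integral_add (hint (P c) (.X ^ (j : ℕ)))
          (hint (P d) (.X ^ (j : ℕ)))
        simpa [add_mul] using h
      map_smul' := fun r c => by
        ext j
        simp [mul_assoc] }
  have hT : Function.Injective T := by
    rw [← LinearMap.ker_eq_bot, LinearMap.ker_eq_bot']
    intro c hc
    have hsq : ∫ s in (0:ℝ)..1, (P c).eval s * (P c).eval s = 0 := by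
      have h1 : ∀ s : ℝ, (P c).eval s * (P c).eval s =
          ∑ j : Fin n, c j * ((P c).eval s * s ^ (j : ℕ)) := by
        intro s
        have : (P c).eval s = ∑ j : Fin n, c j * s ^ (j : ℕ) := by
          simp [P, Polynomial.eval_finsetSum]
        nth_rewrite 1 [this]
        rw [Finset.sum_mul]
        exact Finset.sum_congr rfl fun j _ => by ring
      simp_rw [h1]
      rw [intervalIntegral.integral_finsetSum fun j _ => by
        simpa using (hint (P c) (.X ^ (j : ℕ))).const_mul (c j)]
      refine Finset.sum_eq_zero fun j _ => ?_
      rw [intervalIntegral.integral_const_mul]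
      exact mul_eq_zero_of_right _ (congrFun hc j)
    have hzero : P c = 0 := by
      refine Polynomial.eq_zero_of_infinite_isRoot _
        ((Icc_infinite (zero_lt_one' ℝ)).mono fun x hx => ?_)
      by_contra hne
      refine (intervalIntegral.integral_pos zero_lt_one
        ((P c).continuous.mul (P c).continuous).continuousOn
        (fun s _ => mul_self_nonneg _) ⟨x, hx, mul_self_pos.2 hne⟩).ne' hsq
    ext j
    have := congrArg (fun p => Polynomial.coeff p (j : ℕ)) hzero
    simpa [P, Polynomial.finsetSum_coeff, Polynomial.coeff_monomial, Fin.val_inj] using this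
  obtain ⟨c, hc⟩ := (LinearMap.injective_iff_surjective.1 hT) v
  exact ⟨P c, fun j => congrFun hc j⟩

theorem sq_integral_le_of_continuousOn {f : ℝ → ℝ} {x y : ℝ} (hf : ContinuousOn f (uIcc x y)) :
    (∫ t in x..y, f t) ^ 2 ≤ |y - x| * |∫ t in x..y, f t ^ 2| := by
  wlog hxy : x ≤ y generalizing x y
  · have := this (x := y) (y := x) (by rwa [uIcc_comm]) (le_of_not_ge hxy)
    rwa [intervalIntegral.integral_symm x y, intervalIntegral.integral_symm x y, neg_sq, abs_neg,
      abs_sub_comm] at this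
  rcases hxy.eq_or_lt with rfl | hlt
  · simp
  set I := ∫ t in x..y, f t with hI
  have hfi : IntervalIntegrable f volume x y := hf.intervalIntegrable
  have hfi2 : IntervalIntegrable (fun t => f t ^ 2) volume x y := (hf.pow 2).intervalIntegrable
  have h0 : 0 ≤ ∫ t in x..y, ((y - x) * f t - I) ^ 2 :=
    intervalIntegral.integral_nonneg hxy fun t _ => sq_nonneg _
  have h1 : ∫ t in x..y, ((y - x) * f t - I) ^ 2 =
      (y - x) ^ 2 * (∫ t in x..y, f t ^ 2) - (2 * (y - x) * I) * I + (y - x) * I ^ 2 := by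
    have h2 : ∀ t, ((y - x) * f t - I) ^ 2 =
        (y - x) ^ 2 * f t ^ 2 - (2 * (y - x) * I) * f t + I ^ 2 := fun t => by ring
    simp_rw [h2]
    rw [intervalIntegral.integral_add ((hfi2.const_mul _).sub (hfi.const_mul _)) (by simp),
      intervalIntegral.integral_sub (hfi2.const_mul _) (hfi.const_mul _)]
    simp [← hI]
  have hpos : 0 < y - x := sub_pos.2 hlt
  rw [abs_of_pos hpos, abs_of_nonneg (intervalIntegral.integral_nonneg hxy fun t _ => sq_nonneg _)]
  rw [h1] at h0
  refine le_of_mul_le_mul_left ?_ hpos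
  nlinarith

theorem abs_integral_le_integral_Icc {f : ℝ → ℝ} {a b x y : ℝ} (hab : a ≤ b)
    (hx : x ∈ Icc a b) (hy : y ∈ Icc a b) (hf : ContinuousOn f (Icc a b)) (h0 : ∀ t, 0 ≤ f t) :
    |∫ t in x..y, f t| ≤ ∫ t in a..b, f t := by
  rw [← abs_of_nonneg (intervalIntegral.integral_nonneg hab fun t _ => h0 t)]
  refine intervalIntegral.abs_integral_mono_interval ?_ (ae_of_all _ h0)
    (hf.intervalIntegrable_of_Icc hab)
  rw [uIoc_of_le hab]
  exact Ioc_subset_Ioc (le_min hx.1 hy.1) (max_le hx.2 hy.2)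

theorem norm_sub_taylorWithinEval_le {E : Type*} [NormedAddCommGroup E] [NormedSpace ℝ E]
    [CompleteSpace E] {f : ℝ → E} {a b x₀ x : ℝ} {n : ℕ} (hab : a < b)
    (hf : ContDiffOn ℝ (n + 1 : ℕ) f (Icc a b)) (hx₀ : x₀ ∈ Icc a b) (hx : x ∈ Icc a b) :
    ‖f x - taylorWithinEval f n (Icc a b) x₀ x‖ ≤
      |x - x₀| ^ n * |∫ t in x₀..x, ‖iteratedDerivWithin (n + 1) f (Icc a b) t‖| := by
  have hsub : uIcc x₀ x ⊆ Icc a b := ordConnected_Icc.uIcc_subset hx₀ hx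
  have hu := uniqueDiffOn_Icc hab
  have hG : ContinuousOn (iteratedDerivWithin (n + 1) f (Icc a b)) (uIcc x₀ x) :=
    (hf.continuousOn_iteratedDerivWithin le_rfl hu).mono hsub
  have hfn : ContDiffOn ℝ n f (Icc a b) := hf.of_le (by exact_mod_cast n.le_succ)
  have hG' : ContinuousOn (fun t => ((n.factorial : ℝ)⁻¹ * (x - t) ^ n) •
      iteratedDerivWithin (n + 1) f (Icc a b) t) (uIcc x₀ x) := by
    fun_prop
  have hftc := intervalIntegral.integral_eq_sub_of_hasDeriv_right
    (f := fun y => taylorWithinEval f n (Icc a b) y x)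
    ((continuousOn_taylorWithinEval hu hfn).mono hsub) (fun t ht => by
      have ht' : t ∈ Ioo a b := ⟨(le_min hx₀.1 hx.1).trans_lt ht.1,
        ht.2.trans_le (max_le hx₀.2 hx.2)⟩
      exact (taylorWithinEval_hasDerivAt_Ioo x hab ht' hfn
        ((hf.differentiableOn_iteratedDerivWithin (by exact_mod_cast n.lt_succ_self) hu).mono
          Ioo_subset_Icc_self)).hasDerivWithinAt) hG'.intervalIntegrable
  rw [taylorWithinEval_self] at hftc
  rw [← hftc, ← abs_of_nonneg (pow_nonneg (abs_nonneg (x - x₀)) n), ← abs_mul,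
    ← intervalIntegral.integral_const_mul]
  refine intervalIntegral.norm_integral_le_abs_of_norm_le ?_
    (hG.norm.intervalIntegrable.const_mul _)
  refine (ae_restrict_mem measurableSet_uIoc).mono fun t ht => ?_
  rw [norm_smul, norm_mul, norm_pow, Real.norm_eq_abs (x - t)]
  gcongr
  have h1 : ‖(n.factorial : ℝ)⁻¹‖ ≤ 1 := by
    rw [norm_inv, RCLike.norm_natCast]
    exact inv_le_one_of_one_le₀ (by exact_mod_cast n.factorial_pos)
  have h2 : |x - t| ≤ |x - x₀| := by
    have := uIoc_subset_uIcc ht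
    rw [uIcc_comm] at this
    rw [abs_sub_comm, abs_sub_comm x x₀]
    exact abs_sub_left_of_mem_uIcc this
  calc _ ≤ 1 * |x - x₀| ^ n := by gcongr
    _ = _ := one_mul _

theorem exists_pow_mul_norm_iteratedDerivWithin_sq_le (E : Type*) [NormedAddCommGroup E]
    [NormedSpace ℝ E] [CompleteSpace E] {n k : ℕ} (hk : k ≤ n) :
    ∃ K : ℝ, 0 < K ∧ ∀ (f : ℝ → E) (a b : ℝ), a < b → ContDiffOn ℝ (n + 1 : ℕ) f (Icc a b) →
      ∀ x c : ℝ, c ≠ 0 → x ∈ Icc a b → x + c ∈ Icc a b →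
        |c| ^ (2 * k) * ‖iteratedDerivWithin k f (Icc a b) x‖ ^ 2 ≤
          K * (|c|⁻¹ * (∫ t in a..b, ‖f t‖ ^ 2) +
            |c| ^ (2 * n + 1) * ∫ t in a..b, ‖iteratedDerivWithin (n + 1) f (Icc a b) t‖ ^ 2) := by
  obtain ⟨w, hw⟩ := exists_polynomial_moment_eq (n + 1)
    (fun j => if (j : ℕ) = k then (k.factorial : ℝ) else 0)
  obtain ⟨M, hM⟩ := isCompact_Icc.exists_bound_of_continuousOn
    (s := Icc (0 : ℝ) 1) w.continuous.continuousOn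
  refine ⟨2 * M ^ 2 + 1, by positivity, fun f a b hab hf x c hc hx hxc => ?_⟩
  have hM0 : 0 ≤ M := (norm_nonneg _).trans (hM 0 (by simp))
  set s := Icc a b with hs
  set G := iteratedDerivWithin (n + 1) f s with hG
  have hGc : ContinuousOn G s :=
    hf.continuousOn_iteratedDerivWithin le_rfl (uniqueDiffOn_Icc hab)
  have hmem : ∀ t ∈ Icc (0 : ℝ) 1, x + c * t ∈ s := fun t ht => by
    have := (convex_Icc a b).add_smul_mem hx hxc ht
    rwa [smul_eq_mul, mul_comm] at this
  have hfc : ContinuousOn (fun t => f (x + c * t)) (Icc 0 1) :=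
    hf.continuousOn.comp (by fun_prop) hmem
  have hTc : Continuous (fun t : ℝ => taylorWithinEval f n s x (x + c * t)) := by
    simp_rw [taylor_within_apply]
    fun_prop
  set J := |∫ t in x..(x + c), ‖G t‖| with hJ
  -- the kernel `w` extracts the `k`-th Taylor coefficient
  have hcoeff : ∫ t in (0:ℝ)..1, w.eval t • taylorWithinEval f n s x (x + c * t) =
      c ^ k • iteratedDerivWithin k f s x := by
    have h1 : ∀ t : ℝ, w.eval t • taylorWithinEval f n s x (x + c * t) =
        ∑ j ∈ Finset.range (n + 1), (w.eval t * t ^ j) •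
          (((j.factorial : ℝ)⁻¹ * c ^ j) • iteratedDerivWithin j f s x) := by
      intro t
      rw [taylor_within_apply, Finset.smul_sum]
      refine Finset.sum_congr rfl fun j _ => ?_
      rw [smul_smul, smul_smul, add_sub_cancel_left, mul_pow]
      congr 1
      ring
    simp_rw [h1]
    rw [intervalIntegral.integral_finsetSum fun j _ =>
      Continuous.intervalIntegrable (by fun_prop) _ _]
    simp_rw [intervalIntegral.integral_smul_const]
    rw [Finset.sum_eq_single_of_mem k (Finset.mem_range.2 (Nat.lt_succ_of_le hk))]
    · have := hw ⟨k, Nat.lt_succ_of_le hk⟩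
      simp only [if_true] at this
      rw [this, smul_smul, mul_inv_cancel_left₀ (by exact_mod_cast k.factorial_ne_zero)]
    · intro j hj hjk
      have := hw ⟨j, Finset.mem_range.1 hj⟩
      simp only [if_neg hjk] at this
      rw [this, zero_smul]
  have hnorm : ‖c ^ k • iteratedDerivWithin k f s x‖ ≤
      M * (∫ t in (0:ℝ)..1, ‖f (x + c * t)‖) + M * (|c| ^ n * J) := by
    rw [← hcoeff]
    have hint : IntervalIntegrable (fun t => ‖f (x + c * t)‖) volume 0 1 :=
      hfc.norm.intervalIntegrable_of_Icc zero_le_one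
    have : M * (∫ t in (0:ℝ)..1, ‖f (x + c * t)‖) + M * (|c| ^ n * J) =
        ∫ t in (0:ℝ)..1, (M * ‖f (x + c * t)‖ + M * (|c| ^ n * J)) := by
      rw [intervalIntegral.integral_add (hint.const_mul _) (by simp)]
      simp
    rw [this]
    refine intervalIntegral.norm_integral_le_of_norm_le zero_le_one
      (ae_of_all _ fun t ht => ?_) ((hint.const_mul _).add (by simp))
    have ht' := Ioc_subset_Icc_self ht
    rw [norm_smul, ← mul_add]
    refine mul_le_mul (hM t ht') ?_ (norm_nonneg _) hM0
    have hrem := norm_sub_taylorWithinEval_le hab hf hx (hmem t ht')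
    have hct : |x + c * t - x| ≤ |c| := by
      rw [add_sub_cancel_left, abs_mul, abs_of_nonneg ht'.1]
      exact mul_le_of_le_one_right (abs_nonneg c) ht'.2
    have hsub : uIoc x (x + c * t) ⊆ uIoc x (x + c) := by
      rcases le_total 0 c with h | h
      · rw [uIoc_of_le (by nlinarith [ht'.1]), uIoc_of_le (by linarith)]
        exact Ioc_subset_Ioc_right (by nlinarith [ht'.2])
      · rw [uIoc_of_ge (by nlinarith [ht'.1]), uIoc_of_ge (by linarith)]
        exact Ioc_subset_Ioc_left (by nlinarith [ht'.2])
    have hJle : |∫ u in x..(x + c * t), ‖G u‖| ≤ J :=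
      intervalIntegral.abs_integral_mono_interval hsub (ae_of_all _ fun _ => norm_nonneg _)
        (hGc.norm.mono (ordConnected_Icc.uIcc_subset hx hxc)).intervalIntegrable
    calc ‖taylorWithinEval f n s x (x + c * t)‖
        ≤ ‖f (x + c * t)‖ + ‖f (x + c * t) - taylorWithinEval f n s x (x + c * t)‖ :=
          norm_le_insert _ _
      _ ≤ ‖f (x + c * t)‖ + |c| ^ n * J := by
          gcongr
          exact hrem.trans (by gcongr)
  have hf2 : (∫ t in (0:ℝ)..1, ‖f (x + c * t)‖) ^ 2 ≤ |c|⁻¹ * ∫ t in a..b, ‖f t‖ ^ 2 := by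
    refine (sq_integral_le_of_continuousOn (by rw [uIcc_of_le zero_le_one]; exact hfc.norm)).trans ?_
    rw [intervalIntegral.integral_comp_add_mul (fun u => ‖f u‖ ^ 2) hc]
    simp only [sub_zero, abs_one, one_mul, mul_zero, add_zero, mul_one, smul_eq_mul, abs_mul,
      abs_inv]
    gcongr
    exact abs_integral_le_integral_Icc hab.le hx hxc (hf.continuousOn.norm.pow 2)
      fun _ => sq_nonneg _
  have hJ2 : J ^ 2 ≤ |c| * ∫ t in a..b, ‖G t‖ ^ 2 := by
    rw [hJ, sq_abs]
    refine (sq_integral_le_of_continuousOn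
      (hGc.norm.mono (ordConnected_Icc.uIcc_subset hx hxc))).trans ?_
    rw [add_sub_cancel_left]
    gcongr
    exact abs_integral_le_integral_Icc hab.le hx hxc (hGc.norm.pow 2) fun _ => sq_nonneg _
  set A := ∫ t in (0:ℝ)..1, ‖f (x + c * t)‖
  set X := |c|⁻¹ * ∫ t in a..b, ‖f t‖ ^ 2
  set Y := ∫ t in a..b, ‖G t‖ ^ 2
  have hY : (|c| ^ n * J) ^ 2 ≤ |c| ^ (2 * n + 1) * Y :=
    calc (|c| ^ n * J) ^ 2 = |c| ^ (2 * n) * J ^ 2 := by ring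
      _ ≤ |c| ^ (2 * n) * (|c| * Y) := by gcongr
      _ = _ := by ring
  calc |c| ^ (2 * k) * ‖iteratedDerivWithin k f s x‖ ^ 2
      = ‖c ^ k • iteratedDerivWithin k f s x‖ ^ 2 := by
        rw [norm_smul, norm_pow, Real.norm_eq_abs]; ring
    _ ≤ (M * A + M * (|c| ^ n * J)) ^ 2 := by gcongr
    _ ≤ 2 * ((M * A) ^ 2 + (M * (|c| ^ n * J)) ^ 2) := add_sq_le
    _ = 2 * M ^ 2 * (A ^ 2 + (|c| ^ n * J) ^ 2) := by ring
    _ ≤ 2 * M ^ 2 * (X + |c| ^ (2 * n + 1) * Y) := by gcongr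
    _ ≤ (2 * M ^ 2 + 1) * (X + |c| ^ (2 * n + 1) * Y) := by
        have := (sq_nonneg A).trans hf2
        have := (sq_nonneg _).trans hY
        gcongr
        linarith

/-- **Sobolev interpolation inequality (L^∞ version).**
For integers `n ≥ 2`, `m ≥ 1` and `0 ≤ k < n` there is a constant `C > 0`, depending only on
`k`, `n` and `m`, such that for every `ℓ > 0`, every `a` with `0 < a ≤ ℓ` and every `n`-times
continuously differentiable `H : [0, ℓ] → ℝ^m`,
`a^(2k) sup_{θ∈[0,ℓ]} ‖H⁽ᵏ⁾(θ)‖² ≤ C (a⁻¹ ∫₀^ℓ ‖H‖² + a^(2n-1) ∫₀^ℓ ‖H⁽ⁿ⁾‖²)`. -/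
theorem interpolation_inequality_Linfty (n m k : ℕ) (hn : 2 ≤ n) (hm : 1 ≤ m) (hk : k < n) :
    ∃ C : ℝ, 0 < C ∧
      ∀ ℓ : ℝ, 0 < ℓ → ∀ a : ℝ, 0 < a → a ≤ ℓ →
        ∀ H : ℝ → EuclideanSpace ℝ (Fin m), ContDiffOn ℝ n H (Icc 0 ℓ) →
          ∀ θ ∈ Icc (0:ℝ) ℓ,
            a ^ (2 * k) * ‖iteratedDerivWithin k H (Icc 0 ℓ) θ‖ ^ 2 ≤
              C * (a⁻¹ * (∫ σ in (0:ℝ)..ℓ, ‖H σ‖ ^ 2) +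
                a ^ (2 * n - 1) * ∫ σ in (0:ℝ)..ℓ, ‖iteratedDerivWithin n H (Icc 0 ℓ) σ‖ ^ 2) := by
  obtain ⟨p, rfl⟩ : ∃ p, n = p + 1 := ⟨n - 1, by omega⟩
  obtain ⟨K, hK, hmain⟩ := exists_pow_mul_norm_iteratedDerivWithin_sq_le
    (EuclideanSpace ℝ (Fin m)) (Nat.le_of_lt_succ hk)
  refine ⟨4 ^ k * (2 * K), by positivity, fun ℓ hℓ a ha haℓ H hH θ hθ => ?_⟩
  obtain ⟨c, hca, hc⟩ : ∃ c : ℝ, |c| = a / 2 ∧ θ + c ∈ Icc (0:ℝ) ℓ := by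
    rcases le_total θ (ℓ / 2) with h | h
    · exact ⟨a / 2, abs_of_pos (by positivity), by linarith [hθ.1], by linarith⟩
    · exact ⟨-(a / 2), by rw [abs_neg, abs_of_pos (by positivity)], by linarith, by linarith [hθ.2]⟩
  have hc0 : c ≠ 0 := abs_pos.1 (by rw [hca]; positivity)
  have key := hmain H 0 ℓ hℓ hH θ c hc0 hθ hc
  rw [hca] at key
  set X := ∫ σ in (0:ℝ)..ℓ, ‖H σ‖ ^ 2
  set Y := ∫ σ in (0:ℝ)..ℓ, ‖iteratedDerivWithin (p + 1) H (Icc 0 ℓ) σ‖ ^ 2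
  have hY : 0 ≤ Y := intervalIntegral.integral_nonneg hℓ.le fun _ _ => sq_nonneg _
  have hle : (a / 2) ^ (2 * p + 1) ≤ 2 * a ^ (2 * p + 1) :=
    (pow_le_pow_left₀ (by positivity) (half_le_self ha.le) _).trans
      (le_mul_of_one_le_left (by positivity) one_le_two)
  have hexp : 2 * (p + 1) - 1 = 2 * p + 1 := by omega
  rw [hexp]
  calc a ^ (2 * k) * ‖iteratedDerivWithin k H (Icc 0 ℓ) θ‖ ^ 2
      = 4 ^ k * ((a / 2) ^ (2 * k) * ‖iteratedDerivWithin k H (Icc 0 ℓ) θ‖ ^ 2) := by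
        rw [← mul_assoc, pow_mul, pow_mul, ← mul_pow]
        congr 2
        ring
    _ ≤ 4 ^ k * (K * ((a / 2)⁻¹ * X + (a / 2) ^ (2 * p + 1) * Y)) := by gcongr
    _ ≤ 4 ^ k * (K * ((a / 2)⁻¹ * X + 2 * a ^ (2 * p + 1) * Y)) := by gcongr
    _ = 4 ^ k * (2 * K) * (a⁻¹ * X + a ^ (2 * p + 1) * Y) := by
        rw [inv_div]
        ring
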